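/- arXiv:2601.06515 — 11 statements merged into one kernel-verified Lean document; each statement's English description precedes it below -/
import Mathlib

section
/- Consider the opinion dynamics system (2.1). Suppose that (a) no nonempty subset of the unopinionated agents V₂ is a cohesive agent set, and (b) there exists a weak cohesive group set Q* ⊆ {1,…,l} consisting only of opinionated agents (i.e., a_{kj} = 0 for every k ∈ Q* and every j ∈ V₂). Then for every initial opinion vector x(0) ∈ ℝⁿ, every trajectory of the system achieves asymptotic consensus at the common bias: lim_{t→∞} x_i(t) = u for every agent i ∈ V. -/
open Filter Topology

def IsWeightVec {n : ℕ} (w : Fin n → ℝ) : Prop :=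
  (∀ j, 0 ≤ w j) ∧ (∑ j, w j) = 1

def IsWMedian {n : ℕ} (w : Fin n → ℝ) (x : Fin n → ℝ) (a : ℝ) : Prop :=
  (∑ j ∈ Finset.univ.filter (fun j => x j < a), w j) ≤ 1 / 2 ∧
  (∑ j ∈ Finset.univ.filter (fun j => a < x j), w j) ≤ 1 / 2

def RowStochastic {m n : ℕ} (A : Matrix (Fin m) (Fin n) ℝ) : Prop :=
  ∀ i, IsWeightVec (A i)

/-- A trajectory of the opinion dynamics system (2.1): at each time step each agent
mixes its bias `u` (with weight `lam i`) with an external opinion built from some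
weighted median of the agent opinions and some weighted median of the environmental
opinions `A.mulVec (x t)`. -/
def IsTrajectory {n l : ℕ} (lam γ : Fin n → ℝ) (u : ℝ)
    (W : Matrix (Fin n) (Fin n) ℝ) (M : Matrix (Fin n) (Fin l) ℝ)
    (A : Matrix (Fin l) (Fin n) ℝ) (x : ℕ → Fin n → ℝ) : Prop :=
  ∀ t i, ∃ m mhat : ℝ,
    IsWMedian (W i) (x t) m ∧
    IsWMedian (M i) (A.mulVec (x t)) mhat ∧
    x (t + 1) i = lam i * u + (1 - lam i) * ((1 - γ i) * m + γ i * mhat)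

/-- A nonempty `P ⊆ V` is a cohesive agent set if every member places at least
half of its total weight inside `P`. -/
def CohesiveAgentSet {n : ℕ} (W : Matrix (Fin n) (Fin n) ℝ) (P : Finset (Fin n)) : Prop :=
  P.Nonempty ∧ ∀ i ∈ P, 1 / 2 ≤ ∑ j ∈ P, W i j

/-- A nonempty `Q ⊆ {1,…,l}` is a weak cohesive group set if every agent places more
than half of its environmental weight on the simplices in `Q`. -/
def WeakCohesiveGroupSet {n l : ℕ} (M : Matrix (Fin n) (Fin l) ℝ)
    (Q : Finset (Fin l)) : Prop :=
  Q.Nonempty ∧ ∀ i, 1 / 2 < ∑ k ∈ Q, M i k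

/-- Points carrying more than half of the total weight trap every weighted median. -/
theorem IsWMedian.abs_sub_le {n : ℕ} {w y : Fin n → ℝ} {a u K : ℝ} (hw : IsWeightVec w)
    (ha : IsWMedian w y a) (S : Finset (Fin n)) (hS : 1 / 2 < ∑ j ∈ S, w j)
    (hK : ∀ j ∈ S, |y j - u| ≤ K) : |a - u| ≤ K := by
  by_contra! h
  rcases lt_abs.1 h with h | h
  · have hsub : S ⊆ Finset.univ.filter (fun j => y j < a) := fun j hj => by
      have := (abs_le.1 (hK j hj)).2
      simp only [Finset.mem_filter, Finset.mem_univ, true_and]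
      linarith
    have := Finset.sum_le_sum_of_subset_of_nonneg hsub fun j _ _ => hw.1 j
    linarith [ha.1]
  · have hsub : S ⊆ Finset.univ.filter (fun j => a < y j) := fun j hj => by
      have := (abs_le.1 (hK j hj)).1
      simp only [Finset.mem_filter, Finset.mem_univ, true_and]
      linarith
    have := Finset.sum_le_sum_of_subset_of_nonneg hsub fun j _ _ => hw.1 j
    linarith [ha.2]

/-- A weighted average stays within `K` of `u` when all points of positive weight do. -/
theorem IsWeightVec.abs_sum_mul_sub_le {n : ℕ} {w y : Fin n → ℝ} {u K : ℝ}
    (hw : IsWeightVec w) (hK : ∀ j, w j ≠ 0 → |y j - u| ≤ K) :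
    |∑ j, w j * y j - u| ≤ K := by
  have h : ∑ j, w j * y j - u = ∑ j, w j * (y j - u) := by
    simp only [mul_sub, Finset.sum_sub_distrib, ← Finset.sum_mul, hw.2, one_mul]
  calc |∑ j, w j * y j - u| ≤ ∑ j, |w j * (y j - u)| := h ▸ Finset.abs_sum_le_sum_abs _ _
    _ ≤ ∑ j, w j * K := by
      refine Finset.sum_le_sum fun j _ => ?_
      by_cases h0 : w j = 0
      · simp [h0]
      · rw [abs_mul, abs_of_nonneg (hw.1 j)]
        exact mul_le_mul_of_nonneg_left (hK j h0) (hw.1 j)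
    _ = K := by rw [← Finset.sum_mul, hw.2, one_mul]

theorem abs_bias_mix_sub_le {lam γ u m m' K : ℝ} (hlam : lam ≤ 1) (hγ : 0 ≤ γ ∧ γ ≤ 1)
    (hm : |m - u| ≤ K) (hm' : |m' - u| ≤ K) :
    |lam * u + (1 - lam) * ((1 - γ) * m + γ * m') - u| ≤ (1 - lam) * K := by
  have h : lam * u + (1 - lam) * ((1 - γ) * m + γ * m') - u =
      (1 - lam) * ((1 - γ) * (m - u) + γ * (m' - u)) := by ring
  rw [h, abs_mul, abs_of_nonneg (sub_nonneg.2 hlam)]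
  refine mul_le_mul_of_nonneg_left ?_ (sub_nonneg.2 hlam)
  rw [abs_le] at hm hm' ⊢
  constructor <;> nlinarith

section Trajectory

variable {n l : ℕ} {lam γ : Fin n → ℝ} {u : ℝ} {W : Matrix (Fin n) (Fin n) ℝ}
  {M : Matrix (Fin n) (Fin l) ℝ} {A : Matrix (Fin l) (Fin n) ℝ} {x : ℕ → Fin n → ℝ}

/-- One step of the dynamics contracts by `1 - lam i`, provided agent `i` places more than half
of its weight on agents within `K` of `u`, and more than half of its environmental weight on
groups all of whose members are within `K` of `u`. -/
theorem IsTrajectory.abs_succ_sub_le (htraj : IsTrajectory lam γ u W M A x)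
    (hW : RowStochastic W) (hM : RowStochastic M) (hA : RowStochastic A)
    {i : Fin n} (hlam : lam i ≤ 1) (hγ : 0 ≤ γ i ∧ γ i ≤ 1) {t : ℕ} {K : ℝ}
    (S : Finset (Fin n)) (hS : 1 / 2 < ∑ j ∈ S, W i j) (hSK : ∀ j ∈ S, |x t j - u| ≤ K)
    (Q : Finset (Fin l)) (hQ : 1 / 2 < ∑ k ∈ Q, M i k)
    (hQK : ∀ k ∈ Q, ∀ j, A k j ≠ 0 → |x t j - u| ≤ K) :
    |x (t + 1) i - u| ≤ (1 - lam i) * K := by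
  obtain ⟨m, m', hm, hm', hx⟩ := htraj t i
  rw [hx]
  exact abs_bias_mix_sub_le hlam hγ (hm.abs_sub_le (hW i) S hS hSK)
    (hm'.abs_sub_le (hM i) Q hQ fun k hk => (hA k).abs_sum_mul_sub_le (hQK k hk))

theorem IsTrajectory.abs_succ_sub_le_of_forall (htraj : IsTrajectory lam γ u W M A x)
    (hW : RowStochastic W) (hM : RowStochastic M) (hA : RowStochastic A)
    {i : Fin n} (hlam : lam i ≤ 1) (hγ : 0 ≤ γ i ∧ γ i ≤ 1) {t : ℕ} {K : ℝ}
    (hK : ∀ j, |x t j - u| ≤ K) : |x (t + 1) i - u| ≤ (1 - lam i) * K :=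
  htraj.abs_succ_sub_le hW hM hA hlam hγ Finset.univ (by rw [(hW i).2]; norm_num)
    (fun j _ => hK j) Finset.univ (by rw [(hM i).2]; norm_num) fun _ _ j _ => hK j

/-- If all agents outside `V₂` are eventually within `K` of `u`, no subset of `V₂` is cohesive, and
every agent gives more than half of its environmental weight to groups avoiding `V₂`, then all
agents are eventually within `K` of `u`. -/
theorem IsTrajectory.eventually_abs_sub_le (htraj : IsTrajectory lam γ u W M A x)
    (hW : RowStochastic W) (hM : RowStochastic M) (hA : RowStochastic A)
    {V₂ : Finset (Fin n)} (hlam : ∀ i ∈ V₂, lam i = 0) (hγ : ∀ i, 0 ≤ γ i ∧ γ i ≤ 1)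
    (hnoco : ∀ P : Finset (Fin n), P ⊆ V₂ → ¬ CohesiveAgentSet W P)
    {Q : Finset (Fin l)} (hQ : WeakCohesiveGroupSet M Q) (hQA : ∀ k ∈ Q, ∀ j ∈ V₂, A k j = 0)
    {K : ℝ} (hK : ∀ i, i ∉ V₂ → ∀ᶠ t in atTop, |x t i - u| ≤ K) :
    ∀ᶠ t in atTop, ∀ i, |x t i - u| ≤ K := by
  classical
  rw [eventually_all]
  by_contra! hne
  let B : Finset (Fin n) := Finset.univ.filter fun i => ¬ ∀ᶠ t in atTop, |x t i - u| ≤ K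
  have hBV : B ⊆ V₂ := fun i hi => by
    by_contra h
    exact (Finset.mem_filter.1 hi).2 (hK i h)
  have hBne : B.Nonempty := by
    obtain ⟨i, hi⟩ := hne
    exact ⟨i, Finset.mem_filter.2 ⟨Finset.mem_univ i, fun h => hi (h.mono fun _ => not_lt.2)⟩⟩
  have hBco := hnoco B hBV
  simp only [CohesiveAgentSet, hBne, true_and, not_forall, not_le] at hBco
  obtain ⟨i, hiB, hi⟩ := hBco
  refine (Finset.mem_filter.1 hiB).2 ?_
  have hcompl : 1 / 2 < ∑ j ∈ Bᶜ, W i j := by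
    have := Finset.sum_add_sum_compl B (W i)
    rw [(hW i).2] at this
    linarith
  have hlam0 := hlam i (hBV hiB)
  have hgood : ∀ᶠ t in atTop, ∀ j ∈ Bᶜ, |x t j - u| ≤ K := by
    rw [Filter.eventually_all_finset]
    intro j hj
    simpa [B] using hj
  rw [← map_add_atTop_eq_nat 1, eventually_map]
  filter_upwards [hgood] with t ht
  have := htraj.abs_succ_sub_le hW hM hA (by simp [hlam0]) (hγ i) Bᶜ hcompl ht Q (hQ.2 i)
    fun k hk j hj => ht j <| Finset.mem_compl.2 fun hjB => hj (hQA k hk j (hBV hjB))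
  simpa [hlam0] using this

end Trajectory

/-- Theorem 3.1: if no nonempty subset of the unopinionated agents $V_2$ is a cohesive
agent set, but there is a weak cohesive group set consisting only of opinionated agents,
then every trajectory achieves asymptotic consensus at the common bias $u$. -/
theorem stmt0 {n l : ℕ} [NeZero n]
    (V₁ V₂ : Finset (Fin n)) (hV : V₂ = V₁ᶜ)
    (lam γ : Fin n → ℝ) (u : ℝ)
    (hlam₁ : ∀ i ∈ V₁, 0 < lam i ∧ lam i ≤ 1)
    (hlam₂ : ∀ i ∈ V₂, lam i = 0)
    (hγ : ∀ i, 0 ≤ γ i ∧ γ i ≤ 1)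
    (W : Matrix (Fin n) (Fin n) ℝ) (M : Matrix (Fin n) (Fin l) ℝ)
    (A : Matrix (Fin l) (Fin n) ℝ)
    (hW : RowStochastic W) (hM : RowStochastic M) (hA : RowStochastic A)
    (hnoco : ∀ P : Finset (Fin n), P ⊆ V₂ → ¬ CohesiveAgentSet W P)
    (hweak : ∃ Q : Finset (Fin l), WeakCohesiveGroupSet M Q ∧ ∀ k ∈ Q, ∀ j ∈ V₂, A k j = 0)
    (x : ℕ → Fin n → ℝ) (htraj : IsTrajectory lam γ u W M A x) :
    ∀ i, Tendsto (fun t => x t i) atTop (𝓝 u) := by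
  have hlam : ∀ i, lam i ≤ 1 := fun i => by
    by_cases hi : i ∈ V₁
    · exact (hlam₁ i hi).2
    · simp [hlam₂ i (by simpa [hV] using hi)]
  obtain ⟨Q, hQ, hQA⟩ := hweak
  obtain ⟨c, hc0, hc1, hc⟩ : ∃ c : ℝ, 0 ≤ c ∧ c < 1 ∧ ∀ i ∈ V₁, 1 - lam i ≤ c := by
    rcases V₁.eq_empty_or_nonempty with h | h
    · exact ⟨0, le_rfl, one_pos, by simp [h]⟩
    · obtain ⟨i, hi, hmin⟩ := V₁.exists_min_image lam h
      exact ⟨1 - lam i, sub_nonneg.2 (hlam i), by linarith [(hlam₁ i hi).1],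
        fun j hj => by linarith [hmin j hj]⟩
  have hcontract : ∀ K, 0 ≤ K → (∀ᶠ t in atTop, ∀ i, |x t i - u| ≤ K) →
      ∀ᶠ t in atTop, ∀ i, |x t i - u| ≤ c * K := by
    intro K hK0 hK
    refine htraj.eventually_abs_sub_le hW hM hA hlam₂ hγ hnoco hQ hQA fun i hi => ?_
    have hi₁ : i ∈ V₁ := by simpa [hV] using hi
    rw [← map_add_atTop_eq_nat 1, eventually_map]
    filter_upwards [hK] with t ht
    exact (htraj.abs_succ_sub_le_of_forall hW hM hA (hlam i) (hγ i) ht).trans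
      (mul_le_mul_of_nonneg_right (hc i hi₁) hK0)
  obtain ⟨K, hK0, hK⟩ : ∃ K : ℝ, 0 ≤ K ∧ ∀ᶠ t in atTop, ∀ i, |x t i - u| ≤ K := by
    have hK0 : 0 ≤ ∑ j, |x 0 j - u| := Finset.sum_nonneg fun j _ => abs_nonneg _
    refine ⟨_, hK0, Eventually.of_forall fun t => ?_⟩
    induction t with
    | zero =>
      exact fun i => Finset.single_le_sum (f := fun j => |x 0 j - u|)
        (fun j _ => abs_nonneg _) (Finset.mem_univ i)
    | succ t ih =>
      intro i
      have hnonneg : 0 ≤ lam i := by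
        by_cases hi : i ∈ V₁
        · exact (hlam₁ i hi).1.le
        · exact (hlam₂ i (by simpa [hV] using hi)).ge
      exact (htraj.abs_succ_sub_le_of_forall hW hM hA (hlam i) (hγ i) ih).trans
        (mul_le_of_le_one_left hK0 (by linarith))
  have hpow : ∀ p : ℕ, ∀ᶠ t in atTop, ∀ i, |x t i - u| ≤ c ^ p * K := by
    intro p
    induction p with
    | zero => simpa using hK
    | succ p ih =>
      rw [pow_succ', mul_assoc]
      exact hcontract _ (by positivity) ih
  intro i
  rw [Metric.tendsto_nhds]
  intro ε hε
  have hlim : Tendsto (fun p : ℕ => c ^ p * K) atTop (𝓝 0) := by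
    simpa using (tendsto_pow_atTop_nhds_zero_of_lt_one hc0 hc1).mul_const K
  obtain ⟨p, hp⟩ := (hlim.eventually_lt_const hε).exists
  filter_upwards [hpow p] with t ht
  exact (ht i).trans_lt hp
end

section
/- Consider the fully opinionated system with map F. If (1−λ_min)·γ_max < λ_min, then F has a unique fixed point x* ∈ ℝⁿ, and the trajectory defined by x(t+1) = F(x(t)) converges to x* for every initial opinion x(0) ∈ ℝⁿ, with the exponential rate ‖x(t) − x*‖_∞ ≤ ((1−λ_min)(1+γ_max))^t · ‖x(0) − x*‖_∞ for all t ∈ ℕ. -/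
open Filter Topology

variable {n l : ℕ}

/-- λ_min for the fully opinionated system. -/
noncomputable def lamMin (lam : Fin n → ℝ) : ℝ := ⨅ i, lam i

/-- γ_max for the fully opinionated system. -/
noncomputable def gamMax (γ : Fin n → ℝ) : ℝ := ⨆ i, γ i

theorem ContractingWith.dist_iterate_fixedPoint_le {α : Type*} [MetricSpace α] [CompleteSpace α]
    [Nonempty α] {K : NNReal} {f : α → α} (hf : ContractingWith K f) (x : α) (t : ℕ) :
    dist (f^[t] x) (ContractingWith.fixedPoint f hf) ≤
      (K : ℝ) ^ t * dist x (ContractingWith.fixedPoint f hf) := by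
  have h := (hf.toLipschitzWith.iterate t).dist_le_mul x (ContractingWith.fixedPoint f hf)
  rwa [(hf.fixedPoint_isFixedPt.iterate t).eq, NNReal.coe_pow] at h

theorem abs_anchored_combo_sub_le {a g u p q p' q' d : ℝ} (ha : a ≤ 1)
    (hg0 : 0 ≤ g) (hg1 : g ≤ 1) (hp : |p - p'| ≤ d) (hq : |q - q'| ≤ d) :
    |(a * u + (1 - a) * ((1 - g) * p + g * q)) -
      (a * u + (1 - a) * ((1 - g) * p' + g * q'))| ≤ (1 - a) * d := by
  have hcombo : |(1 - g) * (p - p') + g * (q - q')| ≤ d := by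
    rw [abs_le] at *
    constructor <;> nlinarith
  calc _ = |(1 - a) * ((1 - g) * (p - p') + g * (q - q'))| := by congr 1; ring
    _ = (1 - a) * |(1 - g) * (p - p') + g * (q - q')| := by
      rw [abs_mul, abs_of_nonneg (by linarith)]
    _ ≤ (1 - a) * d := mul_le_mul_of_nonneg_left hcombo (by linarith)

/-- Theorem 4.1(i): under $(1-λ_{\min})γ_{\max} < λ_{\min}$, the fully opinionated map
$F$ has a unique fixed point $x^*$ and every trajectory $x(t+1)=F(x(t))$ converges to it
with exponential rate $((1-λ_{\min})(1+γ_{\max}))^t$ in the ℓ∞ norm. -/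
theorem stmt1 {n l : ℕ} [NeZero n]
    (lam γ : Fin n → ℝ) (u : Fin n → ℝ)
    (hlam : ∀ i, 0 < lam i ∧ lam i ≤ 1) (hγ : ∀ i, 0 ≤ γ i ∧ γ i ≤ 1)
    (W : Matrix (Fin n) (Fin n) ℝ) (M : Matrix (Fin n) (Fin l) ℝ)
    (A : Matrix (Fin l) (Fin n) ℝ)
    (hW : RowStochastic W) (hM : RowStochastic M) (hA : RowStochastic A)
    (μ ν : Fin n → (Fin n → ℝ) → ℝ)
    (hμ : ∀ i x, IsWMedian (W i) x (μ i x))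
    (hν : ∀ i x, IsWMedian (M i) (A.mulVec x) (ν i x))
    (hμne : ∀ i x y, |μ i x - μ i y| ≤ ‖x - y‖)
    (hνne : ∀ i x y, |ν i x - ν i y| ≤ ‖x - y‖)
    (F : (Fin n → ℝ) → (Fin n → ℝ))
    (hF : ∀ x i, F x i = lam i * u i + (1 - lam i) * ((1 - γ i) * μ i x + γ i * ν i x))
    (hcond : (1 - lamMin lam) * gamMax γ < lamMin lam) :
    ∃ xstar : Fin n → ℝ, F xstar = xstar ∧ (∀ y, F y = y → y = xstar) ∧
      ∀ x0 : Fin n → ℝ,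
        Tendsto (fun t => F^[t] x0) atTop (𝓝 xstar) ∧
        ∀ t : ℕ, ‖F^[t] x0 - xstar‖ ≤
          ((1 - lamMin lam) * (1 + gamMax γ)) ^ t * ‖x0 - xstar‖ := by
  have hmin : ∀ i, lamMin lam ≤ lam i := fun i =>
    ciInf_le (Set.finite_range lam).bddBelow i
  have hmin1 : lamMin lam ≤ 1 := (hmin 0).trans (hlam 0).2
  have hmax : 0 ≤ gamMax γ := Real.iSup_nonneg fun i => (hγ i).1
  have hK0 : 0 ≤ (1 - lamMin lam) * (1 + gamMax γ) :=
    mul_nonneg (by linarith) (by linarith)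
  have hK1 : (1 - lamMin lam) * (1 + gamMax γ) < 1 := by linarith
  lift (1 - lamMin lam) * (1 + gamMax γ) to NNReal using hK0 with K hK
  have hFK : ContractingWith K F := by
    refine ⟨by exact_mod_cast hK1, LipschitzWith.of_dist_le_mul fun x y => ?_⟩
    rw [dist_eq_norm, dist_eq_norm, hK]
    refine (pi_norm_le_iff_of_nonneg (by rw [← hK]; positivity)).2 fun i => ?_
    rw [Pi.sub_apply, Real.norm_eq_abs, hF, hF]
    refine (abs_anchored_combo_sub_le (hlam i).2 (hγ i).1 (hγ i).2
      (hμne i x y) (hνne i x y)).trans (mul_le_mul_of_nonneg_right ?_ (norm_nonneg _))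
    nlinarith [hmin i]
  refine ⟨ContractingWith.fixedPoint F hFK, hFK.fixedPoint_isFixedPt,
    fun y hy => hFK.fixedPoint_unique hy,
    fun x0 => ⟨hFK.tendsto_iterate_fixedPoint x0, fun t => ?_⟩⟩
  simpa only [dist_eq_norm] using hFK.dist_iterate_fixedPoint_le x0 t
end

section
/- Consider the fully opinionated system with map F, and assume (1−λ_min)·γ_max < λ_min. Then the system x(t+1) = F(x(t)) achieves asymptotic consensus for every initial opinion x(0) ∈ ℝⁿ (i.e., there is a constant c ∈ ℝ with lim_{t→∞} x_i(t) = c for all i and all initial conditions) if and only if u_1 = u_2 = ⋯ = u_n; in that case the consensus value equals the common bias u*. -/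
open Filter Topology

variable {n l : ℕ}

theorem IsWMedian.eq_of_const {n : ℕ} {w : Fin n → ℝ} (hw : IsWeightVec w) {c a : ℝ}
    (h : IsWMedian w (fun _ => c) a) : a = c := by
  obtain ⟨h₁, h₂⟩ := h
  rcases lt_trichotomy a c with hac | hac | hac
  · simp only [hac, Finset.filter_true, hw.2] at h₂
    norm_num at h₂
  · exact hac
  · simp only [hac, Finset.filter_true, hw.2] at h₁
    norm_num at h₁

theorem RowStochastic.mulVec_const {m n : ℕ} {A : Matrix (Fin m) (Fin n) ℝ}
    (hA : RowStochastic A) (c : ℝ) : A.mulVec (fun _ => c) = fun _ => c := by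
  funext i
  simp only [Matrix.mulVec, dotProduct]
  rw [← Finset.sum_mul, (hA i).2, one_mul]

theorem lamMin_le {n : ℕ} (lam : Fin n → ℝ) (i : Fin n) : lamMin lam ≤ lam i :=
  ciInf_le (Set.finite_range lam).bddBelow i

theorem lamMin_pos {n : ℕ} [NeZero n] {lam : Fin n → ℝ} (h : ∀ i, 0 < lam i) :
    0 < lamMin lam := by
  obtain ⟨i, hi⟩ := exists_eq_ciInf_of_finite (f := lam)
  exact (h i).trans_eq hi

theorem abs_anchored_sub_le {lam g u a b a' b' d : ℝ} (hlam : lam ≤ 1) (hg : 0 ≤ g)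
    (hg' : g ≤ 1) (ha : |a - a'| ≤ d) (hb : |b - b'| ≤ d) :
    |(lam * u + (1 - lam) * ((1 - g) * a + g * b)) -
      (lam * u + (1 - lam) * ((1 - g) * a' + g * b'))| ≤ (1 - lam) * d := by
  have hmix : |(1 - g) * (a - a') + g * (b - b')| ≤ d := by
    rw [abs_le] at *
    constructor <;> nlinarith
  calc _ = |(1 - lam) * ((1 - g) * (a - a') + g * (b - b'))| := by ring_nf
    _ = (1 - lam) * |(1 - g) * (a - a') + g * (b - b')| := by
      rw [abs_mul, abs_of_nonneg (sub_nonneg.2 hlam)]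
    _ ≤ (1 - lam) * d := mul_le_mul_of_nonneg_left hmix (sub_nonneg.2 hlam)

/-- Theorem 4.1(ii): under $(1-λ_{\min})γ_{\max} < λ_{\min}$, the system $x(t+1)=F(x(t))$
achieves asymptotic consensus for every initial opinion iff all biases coincide, and in
that case the consensus value is the common bias. -/
theorem stmt2 {n l : ℕ} [NeZero n]
    (lam γ : Fin n → ℝ) (u : Fin n → ℝ)
    (hlam : ∀ i, 0 < lam i ∧ lam i ≤ 1) (hγ : ∀ i, 0 ≤ γ i ∧ γ i ≤ 1)
    (W : Matrix (Fin n) (Fin n) ℝ) (M : Matrix (Fin n) (Fin l) ℝ)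
    (A : Matrix (Fin l) (Fin n) ℝ)
    (hW : RowStochastic W) (hM : RowStochastic M) (hA : RowStochastic A)
    (μ ν : Fin n → (Fin n → ℝ) → ℝ)
    (hμ : ∀ i x, IsWMedian (W i) x (μ i x))
    (hν : ∀ i x, IsWMedian (M i) (A.mulVec x) (ν i x))
    (hμne : ∀ i x y, |μ i x - μ i y| ≤ ‖x - y‖)
    (hνne : ∀ i x y, |ν i x - ν i y| ≤ ‖x - y‖)
    (F : (Fin n → ℝ) → (Fin n → ℝ))
    (hF : ∀ x i, F x i = lam i * u i + (1 - lam i) * ((1 - γ i) * μ i x + γ i * ν i x))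
    (hcond : (1 - lamMin lam) * gamMax γ < lamMin lam) :
    ((∃ c : ℝ, ∀ x0 : Fin n → ℝ, ∀ i,
        Tendsto (fun t => F^[t] x0 i) atTop (𝓝 c)) ↔ ∀ i j, u i = u j) ∧
    (∀ ustar : ℝ, (∀ i, u i = ustar) →
      ∀ x0 : Fin n → ℝ, ∀ i, Tendsto (fun t => F^[t] x0 i) atTop (𝓝 ustar)) := by
  have hconst : ∀ c i, F (fun _ => c) i = lam i * u i + (1 - lam i) * c := by
    intro c i
    have hμc := (hμ i fun _ => c).eq_of_const (hW i)
    have hνc := hν i fun _ => c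
    rw [hA.mulVec_const] at hνc
    rw [hF, hμc, hνc.eq_of_const (hM i)]
    ring
  have hpos : 0 < lamMin lam := lamMin_pos fun i => (hlam i).1
  have hle : lamMin lam ≤ 1 := (lamMin_le lam 0).trans (hlam 0).2
  have hLip : LipschitzWith (1 - lamMin lam).toNNReal F := by
    refine LipschitzWith.of_dist_le_mul fun x y => ?_
    rw [dist_eq_norm, dist_eq_norm, Real.coe_toNNReal _ (sub_nonneg.2 hle)]
    refine (pi_norm_le_iff_of_nonneg (mul_nonneg (sub_nonneg.2 hle) (norm_nonneg _))).2
      fun i => ?_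
    rw [Pi.sub_apply, Real.norm_eq_abs, hF, hF]
    refine (abs_anchored_sub_le (hlam i).2 (hγ i).1 (hγ i).2 (hμne i x y)
      (hνne i x y)).trans ?_
    exact mul_le_mul_of_nonneg_right (by linarith [lamMin_le lam i]) (norm_nonneg _)
  have hcontr : ContractingWith (1 - lamMin lam).toNNReal F :=
    ⟨Real.toNNReal_lt_one.2 (by linarith), hLip⟩
  have hconv : ∀ ustar : ℝ, (∀ i, u i = ustar) →
      ∀ x0 : Fin n → ℝ, ∀ i, Tendsto (fun t => F^[t] x0 i) atTop (𝓝 ustar) := by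
    intro c hc x0 i
    have hfix : Function.IsFixedPt F (fun _ => c) := by
      funext j
      rw [hconst, hc]
      ring
    have hlim := hcontr.tendsto_iterate_fixedPoint x0
    rw [← hcontr.fixedPoint_unique hfix] at hlim
    exact tendsto_pi_nhds.1 hlim i
  refine ⟨⟨?_, fun h => ⟨u 0, hconv _ fun i => h i 0⟩⟩, hconv⟩
  rintro ⟨c, hc⟩
  have hfix : Function.IsFixedPt F (fun _ => c) :=
    isFixedPt_of_tendsto_iterate (tendsto_pi_nhds.2 (hc 0)) hLip.continuous.continuousAt
  have hu : ∀ i, u i = c := by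
    intro i
    have h := congrFun hfix i
    rw [hconst] at h
    exact mul_left_cancel₀ (hlam i).1.ne' (by linarith)
  exact fun i j => (hu i).trans (hu j).symm
end

section
/- Let w ∈ ℝ^n be a weight vector, let i ∈ {1,…,n}, and let P ⊆ {1,…,n} be nonempty such that ∑_{j∈P} w_j > 1/2 if i ∉ P, or ∑_{j∈P} w_j ≥ 1/2 if i ∈ P. Let x ∈ ℝ^n and let x* be a weighted median of x with respect to w that is closest to x_i, i.e., |x* − x_i| ≤ |z − x_i| for every weighted median z of x with respect to w. Then min_{j∈P} x_j ≤ x* ≤ max_{j∈P} x_j. -/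
open Filter Topology

theorem IsWMedian.neg {n : ℕ} {w x : Fin n → ℝ} {a : ℝ} (h : IsWMedian w x a) :
    IsWMedian w (-x) (-a) := by
  simpa [IsWMedian] using And.symm h

/-- A weighted median closest to `x i` is at least some value of `x` on the majority set `P`. -/
theorem IsWMedian.exists_mem_le_of_closest {n : ℕ} {w : Fin n → ℝ} (hw : IsWeightVec w)
    {i : Fin n} {P : Finset (Fin n)} (hP : P.Nonempty)
    (hin : i ∈ P → 1 / 2 ≤ ∑ j ∈ P, w j)
    (hout : i ∉ P → 1 / 2 < ∑ j ∈ P, w j)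
    {x : Fin n → ℝ} {a : ℝ} (hmed : IsWMedian w x a)
    (hclosest : ∀ z, IsWMedian w x z → |a - x i| ≤ |z - x i|) :
    ∃ j ∈ P, x j ≤ a := by
  by_contra! hlt
  have hsub : P ⊆ Finset.univ.filter (fun j => a < x j) := fun j hj => by simpa using hlt j hj
  have hPle : ∑ j ∈ P, w j ≤ 1 / 2 :=
    (Finset.sum_le_sum_of_subset_of_nonneg hsub fun j _ _ => hw.1 j).trans hmed.2
  have hi : i ∈ P := by
    by_contra hi
    exact absurd hPle (hout hi).not_ge
  obtain ⟨k, hk, hmin⟩ := P.exists_min_image x hP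
  have hkmed : IsWMedian w x (x k) := by
    constructor
    · have hle : ∑ j ∈ Finset.univ.filter (fun j => x j < x k), w j ≤ ∑ j ∈ Pᶜ, w j := by
        refine Finset.sum_le_sum_of_subset_of_nonneg (fun j hj => ?_) fun j _ _ => hw.1 j
        rw [Finset.mem_compl]
        exact fun hjP => (hmin j hjP).not_gt (Finset.mem_filter.1 hj).2
      have hsum := Finset.sum_add_sum_compl P w
      linarith [hin hi, hw.2]
    · refine (Finset.sum_le_sum_of_subset_of_nonneg (fun j hj => ?_) fun j _ _ => hw.1 j).trans
        hmed.2
      simpa using (hlt k hk).trans (Finset.mem_filter.1 hj).2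
  have hdist := hclosest (x k) hkmed
  rw [abs_of_nonpos (by linarith [hlt i hi]), abs_of_nonpos (by linarith [hmin i hi])] at hdist
  linarith [hlt k hk]

/-- Lemma 3.2 (Lemma 4.1 of Zhang et al.): if a set $P$ carries more than half of the
weight (at least half when $i ∈ P$), then the weighted median closest to $x_i$ lies
between the minimum and maximum of $x$ over $P$. -/
theorem stmt4 {n : ℕ} (w : Fin n → ℝ) (hw : IsWeightVec w) (i : Fin n)
    (P : Finset (Fin n)) (hP : P.Nonempty)
    (hin : i ∈ P → 1 / 2 ≤ ∑ j ∈ P, w j)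
    (hout : i ∉ P → 1 / 2 < ∑ j ∈ P, w j)
    (x : Fin n → ℝ) (xstar : ℝ)
    (hmed : IsWMedian w x xstar)
    (hclosest : ∀ z, IsWMedian w x z → |xstar - x i| ≤ |z - x i|) :
    P.inf' hP x ≤ xstar ∧ xstar ≤ P.sup' hP x := by
  rw [Finset.inf'_le_iff, Finset.le_sup'_iff]
  refine ⟨hmed.exists_mem_le_of_closest hw hP hin hout hclosest, ?_⟩
  have hclosest_neg : ∀ z, IsWMedian w (-x) z → |-xstar - (-x) i| ≤ |z - (-x) i| := by
    intro z hz
    have hle := hclosest (-z) (by simpa using hz.neg)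
    rw [← abs_neg (xstar - x i), ← abs_neg (-z - x i)] at hle
    convert hle using 2 <;> simp only [Pi.neg_apply] <;> ring
  simpa using hmed.neg.exists_mem_le_of_closest hw hP hin hout hclosest_neg
end

section
/- Let P ⊆ {1,…,n} and Q ⊆ {1,…,l} be nonempty, let A ∈ ℝ^{l×n} be row-stochastic with a_{kj} = 0 for every k ∈ Q and every j ∉ P, and let m ∈ ℝ^l be a weight vector with ∑_{k∈Q} m_k > 1/2. Then for every x ∈ ℝ^n, every weighted median y* of A·x with respect to m satisfies min_{j∈P} x_j ≤ y* ≤ max_{j∈P} x_j. -/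
open Filter Topology

theorem IsWeightVec.sum_mul_mem_Icc_of_support_subset {n : ℕ} {w : Fin n → ℝ}
    (hw : IsWeightVec w) {P : Finset (Fin n)} (h0 : ∀ j, j ∉ P → w j = 0)
    {x : Fin n → ℝ} {a b : ℝ} (hx : ∀ j ∈ P, x j ∈ Set.Icc a b) :
    ∑ j, w j * x j ∈ Set.Icc a b := by
  have bound (j : Fin n) : w j * a ≤ w j * x j ∧ w j * x j ≤ w j * b := by
    by_cases hj : j ∈ P
    · exact ⟨mul_le_mul_of_nonneg_left (hx j hj).1 (hw.1 j),
        mul_le_mul_of_nonneg_left (hx j hj).2 (hw.1 j)⟩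
    · simp [h0 j hj]
  constructor
  · calc a = ∑ j, w j * a := by rw [← Finset.sum_mul, hw.2, one_mul]
      _ ≤ _ := Finset.sum_le_sum fun j _ => (bound j).1
  · calc _ ≤ ∑ j, w j * b := Finset.sum_le_sum fun j _ => (bound j).2
      _ = b := by rw [← Finset.sum_mul, hw.2, one_mul]

theorem IsWMedian.mem_Icc_of_majority {l : ℕ} {m y : Fin l → ℝ} {c a b : ℝ}
    (hc : IsWMedian m y c) (hm : ∀ k, 0 ≤ m k) {Q : Finset (Fin l)}
    (hQ : 1 / 2 < ∑ k ∈ Q, m k) (hy : ∀ k ∈ Q, y k ∈ Set.Icc a b) : c ∈ Set.Icc a b := by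
  constructor
  · by_contra! h
    refine (hQ.trans_le ?_).not_ge hc.2
    exact Finset.sum_le_sum_of_subset_of_nonneg
      (fun k hk => Finset.mem_filter.2 ⟨Finset.mem_univ k, h.trans_le (hy k hk).1⟩)
      fun k _ _ => hm k
  · by_contra! h
    refine (hQ.trans_le ?_).not_ge hc.1
    exact Finset.sum_le_sum_of_subset_of_nonneg
      (fun k hk => Finset.mem_filter.2 ⟨Finset.mem_univ k, (hy k hk).2.trans_lt h⟩)
      fun k _ _ => hm k

/-- If the simplices of $Q$ only involve agents of $P$ and $Q$ carries more than half
of the environmental weight $m$, then any weighted median of $Ax$ w.r.t. $m$ lies between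
the minimum and maximum of $x$ over $P$. -/
theorem stmt5 {n l : ℕ}
    (P : Finset (Fin n)) (hP : P.Nonempty) (Q : Finset (Fin l)) (hQ : Q.Nonempty)
    (A : Matrix (Fin l) (Fin n) ℝ) (hA : RowStochastic A)
    (hA0 : ∀ k ∈ Q, ∀ j, j ∉ P → A k j = 0)
    (m : Fin l → ℝ) (hm : IsWeightVec m) (hmQ : 1 / 2 < ∑ k ∈ Q, m k) :
    ∀ (x : Fin n → ℝ) (ystar : ℝ), IsWMedian m (A.mulVec x) ystar →
      P.inf' hP x ≤ ystar ∧ ystar ≤ P.sup' hP x := by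
  intro x ystar hy
  refine hy.mem_Icc_of_majority hm.1 hmQ fun k hk => ?_
  exact (hA k).sum_mul_mem_Icc_of_support_subset (hA0 k hk)
    fun j hj => ⟨Finset.inf'_le x hj, Finset.le_sup' x hj⟩
end

section
/- Let W ∈ ℝ^{n×n}, M ∈ ℝ^{n×l} and A ∈ ℝ^{l×n} be row-stochastic. Suppose P ⊆ {1,…,n} is a cohesive influential cluster, i.e., P is a cohesive agent set and there exists a strong cohesive group set Q relative to P. Then for every i ∈ P, every γ_i ∈ [0,1] and every x ∈ ℝ^n: if m is a weighted median of x with respect to the i-th row of W that is closest to x_i (|m − x_i| ≤ |z − x_i| for every weighted median z of x with respect to the i-th row of W), and m̂ is any weighted median of A·x with respect to the i-th row of M, then min_{j∈P} x_j ≤ (1−γ_i)·m + γ_i·m̂ ≤ max_{j∈P} x_j. -/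
open Filter Topology

/-- A nonempty `Q` is a strong cohesive group set relative to `P` if every simplex of `Q`
is composed only of agents of `P` and every agent places more than half of its
environmental weight on `Q`. -/
def StrongCohesiveGroupSet {n l : ℕ} (M : Matrix (Fin n) (Fin l) ℝ)
    (A : Matrix (Fin l) (Fin n) ℝ) (P : Finset (Fin n)) (Q : Finset (Fin l)) : Prop :=
  Q.Nonempty ∧ (∀ k ∈ Q, ∀ j, j ∉ P → A k j = 0) ∧ ∀ i, 1 / 2 < ∑ k ∈ Q, M i k

/-- `P` is a cohesive influential cluster if it is a cohesive agent set admitting a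
strong cohesive group set relative to it. -/
def CohesiveInfluentialCluster {n l : ℕ} (W : Matrix (Fin n) (Fin n) ℝ)
    (M : Matrix (Fin n) (Fin l) ℝ) (A : Matrix (Fin l) (Fin n) ℝ)
    (P : Finset (Fin n)) : Prop :=
  CohesiveAgentSet W P ∧ ∃ Q : Finset (Fin l), StrongCohesiveGroupSet M A P Q

/-- An upper bound of `x` over a set carrying at least half of the weight bounds any weighted
median closest to a point below that bound. -/
theorem IsWMedian.le_of_closest {n : ℕ} {w x : Fin n → ℝ} {m y c : ℝ} {P : Finset (Fin n)}
    (hw : IsWeightVec w) (hP : 1 / 2 ≤ ∑ j ∈ P, w j) (hx : ∀ j ∈ P, x j ≤ c) (hy : y ≤ c)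
    (hm : IsWMedian w x m) (hmin : ∀ z, IsWMedian w x z → |m - y| ≤ |z - y|) : m ≤ c := by
  by_contra! hc
  have hlow : ∑ j ∈ Finset.univ.filter (fun j => x j < c), w j ≤ 1 / 2 := by
    refine le_trans (Finset.sum_le_sum_of_subset_of_nonneg ?_ fun j _ _ => hw.1 j) hm.1
    exact Finset.monotone_filter_right _ fun j _ hj => hj.trans hc
  have hhigh : ∑ j ∈ Finset.univ.filter (fun j => c < x j), w j ≤ 1 / 2 := by
    have hsub : ∑ j ∈ Finset.univ.filter (fun j => c < x j), w j ≤ ∑ j ∈ Pᶜ, w j := by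
      refine Finset.sum_le_sum_of_subset_of_nonneg (fun j hj => ?_) fun j _ _ => hw.1 j
      rw [Finset.mem_compl]
      exact fun hjP => (hx j hjP).not_gt (Finset.mem_filter.1 hj).2
    have hsum := Finset.sum_add_sum_compl P w
    linarith [hw.2]
  have h := hmin c ⟨hlow, hhigh⟩
  rw [abs_of_nonneg (by linarith), abs_of_nonneg (by linarith)] at h
  linarith

/-- An upper bound of `x` over a set carrying more than half of the weight bounds every weighted
median. -/
theorem IsWMedian.le_of_half_lt {n : ℕ} {w x : Fin n → ℝ} {m c : ℝ} {Q : Finset (Fin n)}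
    (hw : IsWeightVec w) (hQ : 1 / 2 < ∑ j ∈ Q, w j) (hx : ∀ j ∈ Q, x j ≤ c)
    (hm : IsWMedian w x m) : m ≤ c := by
  by_contra! hc
  have hsub : ∑ j ∈ Q, w j ≤ ∑ j ∈ Finset.univ.filter (fun j => x j < m), w j := by
    refine Finset.sum_le_sum_of_subset_of_nonneg (fun j hj => ?_) fun j _ _ => hw.1 j
    exact Finset.mem_filter.2 ⟨Finset.mem_univ j, (hx j hj).trans_lt hc⟩
  linarith [hm.1]

theorem IsWeightVec.dotProduct_le {n : ℕ} {w x : Fin n → ℝ} {c : ℝ} {P : Finset (Fin n)}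
    (hw : IsWeightVec w) (hP : ∀ j, j ∉ P → w j = 0) (hx : ∀ j ∈ P, x j ≤ c) :
    w ⬝ᵥ x ≤ c := by
  calc w ⬝ᵥ x ≤ ∑ j, w j * c := by
        refine Finset.sum_le_sum fun j _ => ?_
        by_cases hj : j ∈ P
        · exact mul_le_mul_of_nonneg_left (hx j hj) (hw.1 j)
        · simp [hP j hj]
    _ = c := by rw [← Finset.sum_mul, hw.2, one_mul]

theorem StrongCohesiveGroupSet.median_le {n l : ℕ} {M : Matrix (Fin n) (Fin l) ℝ}
    {A : Matrix (Fin l) (Fin n) ℝ} {P : Finset (Fin n)} {Q : Finset (Fin l)}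
    (hM : RowStochastic M) (hA : RowStochastic A) (hQ : StrongCohesiveGroupSet M A P Q)
    {x : Fin n → ℝ} {c a : ℝ} (hx : ∀ j ∈ P, x j ≤ c) {i : Fin n}
    (ha : IsWMedian (M i) (A.mulVec x) a) : a ≤ c :=
  ha.le_of_half_lt (hM i) (hQ.2.2 i) fun k hk => (hA k).dotProduct_le (hQ.2.1 k hk) hx

/-- Lemma 3.3: for a cohesive influential cluster $P$, the external opinion
$(1-γ_i)m + γ_i \hat m$ of any member $i ∈ P$ lies between the minimum and maximum of
$x$ over $P$, where $m$ is the weighted median closest to $x_i$ and $\hat m$ any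
environmental weighted median. -/
theorem stmt6 {n l : ℕ}
    (W : Matrix (Fin n) (Fin n) ℝ) (M : Matrix (Fin n) (Fin l) ℝ)
    (A : Matrix (Fin l) (Fin n) ℝ)
    (hW : RowStochastic W) (hM : RowStochastic M) (hA : RowStochastic A)
    (P : Finset (Fin n)) (hP : CohesiveAgentSet W P)
    (hQ : ∃ Q : Finset (Fin l), StrongCohesiveGroupSet M A P Q) :
    ∀ i ∈ P, ∀ γi : ℝ, 0 ≤ γi → γi ≤ 1 →
      ∀ (x : Fin n → ℝ) (m mhat : ℝ),
        IsWMedian (W i) x m →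
        (∀ z, IsWMedian (W i) x z → |m - x i| ≤ |z - x i|) →
        IsWMedian (M i) (A.mulVec x) mhat →
        P.inf' hP.1 x ≤ (1 - γi) * m + γi * mhat ∧
          (1 - γi) * m + γi * mhat ≤ P.sup' hP.1 x := by
  obtain ⟨Q, hQ⟩ := hQ
  intro i hi γi hγ0 hγ1 x m mhat hm hmin hmhat
  have hsup : ∀ j ∈ P, x j ≤ P.sup' hP.1 x := fun j hj => Finset.le_sup' x hj
  have hinf : ∀ j ∈ P, (-x) j ≤ -P.inf' hP.1 x :=
    fun j hj => neg_le_neg (Finset.inf'_le x hj)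
  have hm_le := hm.le_of_closest (hW i) (hP.2 i hi) hsup (hsup i hi) hmin
  have hmhat_le := hQ.median_le hM hA hsup hmhat
  have hle_m : -m ≤ -P.inf' hP.1 x := by
    refine hm.neg.le_of_closest (hW i) (hP.2 i hi) hinf (hinf i hi) fun z hz => ?_
    have h := hmin (-z) (by simpa using hz.neg)
    rw [Pi.neg_apply, ← abs_neg (-m - -x i), ← abs_neg (z - -x i)]
    convert h using 2 <;> ring
  have hle_mhat : -mhat ≤ -P.inf' hP.1 x :=
    hQ.median_le hM hA hinf (by simpa [Matrix.mulVec_neg] using hmhat.neg)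
  constructor <;> nlinarith
end

section
/- Consider any trajectory of the opinion dynamics system (2.1). (i) If there exists T ≥ 0 such that u ≥ min_{i∈V} x_i(t) for every t ≥ T, then the map t ↦ min_{i∈V} x_i(t) is monotonically non-decreasing on t ≥ T. (ii) If there exists T ≥ 0 such that u ≤ max_{i∈V} x_i(t) for every t ≥ T, then the map t ↦ max_{i∈V} x_i(t) is monotonically non-increasing on t ≥ T. -/
open Filter Topology

theorem IsWMedian.le_of_forall_le {n : ℕ} {w x : Fin n → ℝ} {a c : ℝ}
    (h : IsWMedian w x a) (hw : IsWeightVec w) (hc : ∀ j, c ≤ x j) : c ≤ a := by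
  by_contra! hac
  have hsum := h.2
  rw [Finset.filter_true_of_mem fun j _ => hac.trans_le (hc j), hw.2] at hsum
  norm_num at hsum

theorem RowStochastic.le_mulVec {m n : ℕ} {A : Matrix (Fin m) (Fin n) ℝ}
    (hA : RowStochastic A) {x : Fin n → ℝ} {c : ℝ} (hc : ∀ j, c ≤ x j) (k : Fin m) :
    c ≤ A.mulVec x k := by
  calc c = ∑ j, A k j * c := by rw [← Finset.sum_mul, (hA k).2, one_mul]
    _ ≤ ∑ j, A k j * x j :=
      Finset.sum_le_sum fun j _ => mul_le_mul_of_nonneg_left (hc j) ((hA k).1 j)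

theorem le_convexCombination {s a b c : ℝ} (hs₀ : 0 ≤ s) (hs₁ : s ≤ 1)
    (ha : c ≤ a) (hb : c ≤ b) : c ≤ (1 - s) * a + s * b :=
  (convex_Ici c) ha hb (sub_nonneg.2 hs₁) hs₀ (sub_add_cancel 1 s)

section Trajectory

variable {n l : ℕ} {lam γ : Fin n → ℝ} {u : ℝ} {W : Matrix (Fin n) (Fin n) ℝ}
  {M : Matrix (Fin n) (Fin l) ℝ} {A : Matrix (Fin l) (Fin n) ℝ} {x : ℕ → Fin n → ℝ}

theorem IsTrajectory.neg (h : IsTrajectory lam γ u W M A x) :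
    IsTrajectory lam γ (-u) W M A (-x) := by
  intro t i
  obtain ⟨m, mhat, hm, hmhat, hx⟩ := h t i
  refine ⟨-m, -mhat, hm.neg, ?_, ?_⟩
  · simpa only [Pi.neg_apply, Matrix.mulVec_neg] using hmhat.neg
  · simp only [Pi.neg_apply, hx]
    ring

/-- A lower bound for the opinions and the bias is still a lower bound after one step. -/
theorem IsTrajectory.le_succ (h : IsTrajectory lam γ u W M A x)
    (hlam : ∀ i, 0 ≤ lam i ∧ lam i ≤ 1) (hγ : ∀ i, 0 ≤ γ i ∧ γ i ≤ 1)
    (hW : RowStochastic W) (hM : RowStochastic M) (hA : RowStochastic A)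
    {c : ℝ} {t : ℕ} (hu : c ≤ u) (hc : ∀ j, c ≤ x t j) (i : Fin n) : c ≤ x (t + 1) i := by
  obtain ⟨m, mhat, hm, hmhat, hx⟩ := h t i
  have hmix : c ≤ (1 - γ i) * m + γ i * mhat :=
    le_convexCombination (hγ i).1 (hγ i).2 (hm.le_of_forall_le (hW i) hc)
      (hmhat.le_of_forall_le (hM i) (hA.le_mulVec hc))
  rw [hx, add_comm]
  exact le_convexCombination (hlam i).1 (hlam i).2 hmix hu

/-- An upper bound for the opinions and the bias is still an upper bound after one step. -/
theorem IsTrajectory.succ_le (h : IsTrajectory lam γ u W M A x)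
    (hlam : ∀ i, 0 ≤ lam i ∧ lam i ≤ 1) (hγ : ∀ i, 0 ≤ γ i ∧ γ i ≤ 1)
    (hW : RowStochastic W) (hM : RowStochastic M) (hA : RowStochastic A)
    {c : ℝ} {t : ℕ} (hu : u ≤ c) (hc : ∀ j, x t j ≤ c) (i : Fin n) : x (t + 1) i ≤ c :=
  neg_le_neg_iff.1 <| h.neg.le_succ hlam hγ hW hM hA (neg_le_neg hu)
    (fun j => neg_le_neg (hc j)) i

end Trajectory

/-- Lemma 3.5: (i) if from some time $T$ on the bias $u$ is at least the minimum opinion,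
then the minimum opinion is monotonically non-decreasing from $T$ on; (ii) dually for the
maximum opinion. -/
theorem stmt8 {n l : ℕ} [NeZero n]
    (V₁ V₂ : Finset (Fin n)) (hV : V₂ = V₁ᶜ)
    (lam γ : Fin n → ℝ) (u : ℝ)
    (hlam₁ : ∀ i ∈ V₁, 0 < lam i ∧ lam i ≤ 1)
    (hlam₂ : ∀ i ∈ V₂, lam i = 0)
    (hγ : ∀ i, 0 ≤ γ i ∧ γ i ≤ 1)
    (W : Matrix (Fin n) (Fin n) ℝ) (M : Matrix (Fin n) (Fin l) ℝ)
    (A : Matrix (Fin l) (Fin n) ℝ)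
    (hW : RowStochastic W) (hM : RowStochastic M) (hA : RowStochastic A)
    (x : ℕ → Fin n → ℝ) (htraj : IsTrajectory lam γ u W M A x) :
    (∀ T : ℕ, (∀ t, T ≤ t → (⨅ i, x t i) ≤ u) →
      ∀ s t, T ≤ s → s ≤ t → (⨅ i, x s i) ≤ ⨅ i, x t i) ∧
    (∀ T : ℕ, (∀ t, T ≤ t → u ≤ ⨆ i, x t i) →
      ∀ s t, T ≤ s → s ≤ t → (⨆ i, x t i) ≤ ⨆ i, x s i) := by
  have hlam : ∀ i, 0 ≤ lam i ∧ lam i ≤ 1 := by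
    intro i
    by_cases hi : i ∈ V₁
    · exact ⟨(hlam₁ i hi).1.le, (hlam₁ i hi).2⟩
    · simp [hlam₂ i (by simp [hV, hi])]
  refine ⟨fun T hT s t hs hst => ?_, fun T hT s t hs hst => ?_⟩
  · induction t, hst using Nat.le_induction with
    | base => exact le_rfl
    | succ t hst ih =>
      exact ih.trans <| le_ciInf <| htraj.le_succ hlam hγ hW hM hA (hT t (hs.trans hst))
        (ciInf_le (Set.finite_range _).bddBelow)
  · induction t, hst using Nat.le_induction with
    | base => exact le_rfl
    | succ t hst ih =>
      exact (ciSup_le <| htraj.succ_le hlam hγ hW hM hA (hT t (hs.trans hst))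
        (le_ciSup (Set.finite_range _).bddAbove)).trans ih
end

section
/- Consider any trajectory of the opinion dynamics system (2.1). (i) If there exists T ≥ 0 such that u ≥ max_{i∈V} x_i(T), then u ≥ max_{i∈V} x_i(t) for all t ≥ T, and the map t ↦ min_{i∈V} x_i(t) is monotonically non-decreasing on t ≥ T. (ii) If there exists T ≥ 0 such that u ≤ min_{i∈V} x_i(T), then u ≤ min_{i∈V} x_i(t) for all t ≥ T, and the map t ↦ max_{i∈V} x_i(t) is monotonically non-increasing on t ≥ T. -/
open Filter Topology

theorem IsWMedian.exists_le {n : ℕ} {w x : Fin n → ℝ} {a : ℝ} (hw : IsWeightVec w)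
    (h : IsWMedian w x a) : ∃ j, x j ≤ a := by
  by_contra! hx
  have h₂ := h.2
  rw [Finset.filter_true_of_mem fun j _ => hx j, hw.2] at h₂
  norm_num at h₂

theorem IsWMedian.exists_ge {n : ℕ} {w x : Fin n → ℝ} {a : ℝ} (hw : IsWeightVec w)
    (h : IsWMedian w x a) : ∃ j, a ≤ x j := by
  by_contra! hx
  have h₁ := h.1
  rw [Finset.filter_true_of_mem fun j _ => hx j, hw.2] at h₁
  norm_num at h₁

/-- A convex set containing all entries of a vector contains all its weighted medians. -/
theorem IsWMedian.mem_of_convex {n : ℕ} {w x : Fin n → ℝ} {a : ℝ} {S : Set ℝ}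
    (hS : Convex ℝ S) (hw : IsWeightVec w) (h : IsWMedian w x a) (hx : ∀ j, x j ∈ S) :
    a ∈ S := by
  obtain ⟨i, hi⟩ := h.exists_le hw
  obtain ⟨j, hj⟩ := h.exists_ge hw
  exact hS.ordConnected.out (hx i) (hx j) ⟨hi, hj⟩

theorem RowStochastic.mulVec_mem_of_convex {m n : ℕ} {A : Matrix (Fin m) (Fin n) ℝ}
    {x : Fin n → ℝ} {S : Set ℝ} (hS : Convex ℝ S) (hA : RowStochastic A)
    (hx : ∀ j, x j ∈ S) (i : Fin m) : A.mulVec x i ∈ S :=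
  hS.sum_mem (fun j _ => (hA i).1 j) (hA i).2 fun j _ => hx j

/-- A convex set containing the bias and all opinions at some time contains all later
opinions. -/
theorem IsTrajectory.mem_of_convex {n l : ℕ} {lam γ : Fin n → ℝ} {u : ℝ}
    {W : Matrix (Fin n) (Fin n) ℝ} {M : Matrix (Fin n) (Fin l) ℝ}
    {A : Matrix (Fin l) (Fin n) ℝ} {x : ℕ → Fin n → ℝ} {S : Set ℝ}
    (h : IsTrajectory lam γ u W M A x) (hlam : ∀ i, 0 ≤ lam i ∧ lam i ≤ 1)
    (hγ : ∀ i, 0 ≤ γ i ∧ γ i ≤ 1)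
    (hW : RowStochastic W) (hM : RowStochastic M) (hA : RowStochastic A)
    (hS : Convex ℝ S) (hu : u ∈ S) {s t : ℕ} (hst : s ≤ t) (hs : ∀ i, x s i ∈ S) :
    ∀ i, x t i ∈ S := by
  induction t, hst using Nat.le_induction with
  | base => exact hs
  | succ t _ ih =>
    intro i
    obtain ⟨m, mhat, hm, hmhat, hx⟩ := h t i
    have hmS : m ∈ S := hm.mem_of_convex hS (hW i) ih
    have hmhatS : mhat ∈ S :=
      hmhat.mem_of_convex hS (hM i) (hA.mulVec_mem_of_convex hS ih)
    rw [hx]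
    exact hS hu
      (hS hmS hmhatS (sub_nonneg.2 (hγ i).2) (hγ i).1 (sub_add_cancel _ _))
      (hlam i).1 (sub_nonneg.2 (hlam i).2) (add_sub_cancel _ _)

/-- Lemma 3.6: (i) if at some time $T$ the bias $u$ dominates the maximum opinion, then
it does so at all later times and the minimum opinion is non-decreasing from $T$ on;
(ii) dually. -/
theorem stmt9 {n l : ℕ} [NeZero n]
    (V₁ V₂ : Finset (Fin n)) (hV : V₂ = V₁ᶜ)
    (lam γ : Fin n → ℝ) (u : ℝ)
    (hlam₁ : ∀ i ∈ V₁, 0 < lam i ∧ lam i ≤ 1)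
    (hlam₂ : ∀ i ∈ V₂, lam i = 0)
    (hγ : ∀ i, 0 ≤ γ i ∧ γ i ≤ 1)
    (W : Matrix (Fin n) (Fin n) ℝ) (M : Matrix (Fin n) (Fin l) ℝ)
    (A : Matrix (Fin l) (Fin n) ℝ)
    (hW : RowStochastic W) (hM : RowStochastic M) (hA : RowStochastic A)
    (x : ℕ → Fin n → ℝ) (htraj : IsTrajectory lam γ u W M A x) :
    (∀ T : ℕ, (⨆ i, x T i) ≤ u →
      (∀ t, T ≤ t → (⨆ i, x t i) ≤ u) ∧
      (∀ s t, T ≤ s → s ≤ t → (⨅ i, x s i) ≤ ⨅ i, x t i)) ∧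
    (∀ T : ℕ, u ≤ (⨅ i, x T i) →
      (∀ t, T ≤ t → u ≤ ⨅ i, x t i) ∧
      (∀ s t, T ≤ s → s ≤ t → (⨆ i, x t i) ≤ ⨆ i, x s i)) := by
  have hlam : ∀ i, 0 ≤ lam i ∧ lam i ≤ 1 := by
    intro i
    by_cases hi : i ∈ V₁
    · exact ⟨(hlam₁ i hi).1.le, (hlam₁ i hi).2⟩
    · simp [hlam₂ i (by simpa [hV] using hi)]
  have hinf : ∀ t i, (⨅ j, x t j) ≤ x t i := fun t => ciInf_le (Set.finite_range _).bddBelow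
  have hsup : ∀ t i, x t i ≤ ⨆ j, x t j := fun t => le_ciSup (Set.finite_range _).bddAbove
  have hlower : ∀ {a : ℝ}, a ≤ u → ∀ {s t : ℕ}, s ≤ t → (∀ i, a ≤ x s i) →
      a ≤ ⨅ i, x t i := fun ha _ _ hst hs =>
    le_ciInf (htraj.mem_of_convex hlam hγ hW hM hA (convex_Ici _) ha hst hs)
  have hupper : ∀ {b : ℝ}, u ≤ b → ∀ {s t : ℕ}, s ≤ t → (∀ i, x s i ≤ b) →
      (⨆ i, x t i) ≤ b := fun hb _ _ hst hs =>
    ciSup_le (htraj.mem_of_convex hlam hγ hW hM hA (convex_Iic _) hb hst hs)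
  refine ⟨fun T hT => ?_, fun T hT => ?_⟩
  · have hbound : ∀ t, T ≤ t → (⨆ i, x t i) ≤ u := fun t ht =>
      hupper le_rfl ht fun i => (hsup T i).trans hT
    exact ⟨hbound, fun s t hs hst =>
      hlower ((hinf s 0).trans ((hsup s 0).trans (hbound s hs))) hst (hinf s)⟩
  · have hbound : ∀ t, T ≤ t → u ≤ ⨅ i, x t i := fun t ht =>
      hlower le_rfl ht fun i => hT.trans (hinf T i)
    exact ⟨hbound, fun s t hs hst =>
      hupper ((hbound s hs).trans ((hinf s 0).trans (hsup s 0))) hst (hsup s)⟩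
end

section
/- Non-expansiveness of the weighted median (set-valued form): let w ∈ ℝ^n be a weight vector and let x, y ∈ ℝ^n. Then for every weighted median a of x with respect to w, there exists a weighted median b of y with respect to w such that |a − b| ≤ ‖x − y‖_∞, where ‖·‖_∞ denotes the maximum absolute value of the components. -/
open Filter Topology

theorem isClosed_setOf_sum_indicator_le {ι X : Type*} [Fintype ι] [TopologicalSpace X]
    {w : ι → ℝ} (hw : ∀ j, 0 ≤ w j) {S : ι → Set X} (hS : ∀ j, IsOpen (S j)) (c : ℝ) :
    IsClosed {t | ∑ j, (S j).indicator (fun _ => w j) t ≤ c} :=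
  (lowerSemicontinuous_sum fun j _ =>
    (hS j).lowerSemicontinuous_indicator (hw j)).isClosed_preimage c

theorem isClosed_setOf_sum_lt_le {n : ℕ} {w : Fin n → ℝ} (hw : ∀ j, 0 ≤ w j)
    (y : Fin n → ℝ) (c : ℝ) :
    IsClosed {t | ∑ j ∈ Finset.univ.filter (fun j => y j < t), w j ≤ c} := by
  simpa [Finset.sum_filter, Set.indicator_apply] using
    isClosed_setOf_sum_indicator_le hw (fun j => isOpen_Ioi (a := y j)) c

theorem isClosed_setOf_sum_gt_le {n : ℕ} {w : Fin n → ℝ} (hw : ∀ j, 0 ≤ w j)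
    (y : Fin n → ℝ) (c : ℝ) :
    IsClosed {t | ∑ j ∈ Finset.univ.filter (fun j => t < y j), w j ≤ c} := by
  simpa [Finset.sum_filter, Set.indicator_apply] using
    isClosed_setOf_sum_indicator_le hw (fun j => isOpen_Iio (a := y j)) c

theorem IsWeightVec.sum_lt_add_sum_gt_le_one {n : ℕ} {w : Fin n → ℝ} (hw : IsWeightVec w)
    (y : Fin n → ℝ) (t : ℝ) :
    ∑ j ∈ Finset.univ.filter (fun j => y j < t), w j +
      ∑ j ∈ Finset.univ.filter (fun j => t < y j), w j ≤ 1 := by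
  rw [← hw.2, Finset.sum_filter, Finset.sum_filter, ← Finset.sum_add_distrib]
  refine Finset.sum_le_sum fun j _ => ?_
  have := hw.1 j
  split_ifs <;> linarith

/-- Non-expansiveness of the weighted median (set-valued form): every weighted median of
$x$ is within $‖x-y‖_∞$ of some weighted median of $y$. -/
theorem stmt12 {n : ℕ} (w : Fin n → ℝ) (hw : IsWeightVec w) (x y : Fin n → ℝ) :
    ∀ a : ℝ, IsWMedian w x a →
      ∃ b : ℝ, IsWMedian w y b ∧ |a - b| ≤ ‖x - y‖ := by
  intro a ha
  have hd (j : Fin n) : |x j - y j| ≤ ‖x - y‖ := norm_le_pi_norm (x - y) j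
  have hnorm : 0 ≤ ‖x - y‖ := norm_nonneg _
  have hlow : ∑ j ∈ Finset.univ.filter (fun j => y j < a - ‖x - y‖), w j ≤ 1 / 2 := by
    refine (Finset.sum_le_sum_of_subset_of_nonneg
      (Finset.monotone_filter_right _ fun j _ hj => ?_) fun j _ _ => hw.1 j).trans ha.1
    linarith [(abs_le.1 (hd j)).2]
  have hupp : ∑ j ∈ Finset.univ.filter (fun j => a + ‖x - y‖ < y j), w j ≤ 1 / 2 := by
    refine (Finset.sum_le_sum_of_subset_of_nonneg
      (Finset.monotone_filter_right _ fun j _ hj => ?_) fun j _ _ => hw.1 j).trans ha.2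
    linarith [(abs_le.1 (hd j)).1]
  have hle : a - ‖x - y‖ ≤ a + ‖x - y‖ := by linarith
  obtain ⟨b, hb, hmed⟩ := isPreconnected_closed_iff.1
    (isPreconnected_Icc (a := a - ‖x - y‖) (b := a + ‖x - y‖)) _ _
    (isClosed_setOf_sum_lt_le hw.1 y (1 / 2)) (isClosed_setOf_sum_gt_le hw.1 y (1 / 2))
    (fun t _ => by
      have := hw.sum_lt_add_sum_gt_le_one y t
      by_contra! h
      simp only [Set.mem_union, Set.mem_ofPred_eq, not_or, not_le] at h
      linarith [h.1, h.2])
    ⟨_, Set.left_mem_Icc.2 hle, hlow⟩ ⟨_, Set.right_mem_Icc.2 hle, hupp⟩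
  exact ⟨b, hmed, abs_le.2 ⟨by linarith [hb.2], by linarith [hb.1]⟩⟩
end

section
/- Non-expansiveness of the environmental weighted median: let A ∈ ℝ^{l×n} be row-stochastic, let m ∈ ℝ^l be a weight vector, and let x, y ∈ ℝ^n. Then for every weighted median a of A·x with respect to m, there exists a weighted median b of A·y with respect to m such that |a − b| ≤ ‖x − y‖_∞, where ‖x − y‖_∞ is the maximum absolute value of the components of x − y in ℝ^n. -/
open Filter Topology

/-- Averaging against a weight vector is non-expansive for the sup norm. -/
lemma RowStochastic.abs_mulVec_sub_le {l n : ℕ} {A : Matrix (Fin l) (Fin n) ℝ}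
    (hA : RowStochastic A) (x y : Fin n → ℝ) (i : Fin l) :
    |A.mulVec x i - A.mulVec y i| ≤ ‖x - y‖ := by
  have h : A.mulVec x i - A.mulVec y i = ∑ j, A i j * (x j - y j) := by
    simp [Matrix.mulVec, dotProduct, mul_sub]
  calc |A.mulVec x i - A.mulVec y i| ≤ ∑ j, |A i j * (x j - y j)| := by
        rw [h]; exact Finset.abs_sum_le_sum_abs _ _
    _ ≤ ∑ j, A i j * ‖x - y‖ := by
        refine Finset.sum_le_sum fun j _ => ?_
        rw [abs_mul, abs_of_nonneg ((hA i).1 j)]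
        exact mul_le_mul_of_nonneg_left (norm_le_pi_norm (x - y) j) ((hA i).1 j)
    _ = ‖x - y‖ := by rw [← Finset.sum_mul, (hA i).2, one_mul]

/-- If at most half the weight lies strictly below `c` and at most half strictly above `d`,
then some weighted median lies in `[c, d]`. -/
lemma IsWeightVec.exists_isWMedian_mem_Icc {n : ℕ} {w : Fin n → ℝ} (hw : IsWeightVec w)
    (v : Fin n → ℝ) {c d : ℝ} (hcd : c ≤ d)
    (hc : (∑ j ∈ Finset.univ.filter (fun j => v j < c), w j) ≤ 1 / 2)
    (hd : (∑ j ∈ Finset.univ.filter (fun j => d < v j), w j) ≤ 1 / 2) :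
    ∃ b ∈ Set.Icc c d, IsWMedian w v b := by
  classical
  let T : Finset ℝ := (insert d (Finset.univ.image v)).filter (fun t => c ≤ t ∧ t ≤ d ∧
    (∑ j ∈ Finset.univ.filter (fun j => t < v j), w j) ≤ 1 / 2)
  have hT : T.Nonempty := ⟨d, by
    simp only [T, Finset.mem_filter]
    exact ⟨Finset.mem_insert_self _ _, hcd, le_rfl, hd⟩⟩
  obtain ⟨b, hbT, hmin⟩ := T.exists_min_image id hT
  obtain ⟨-, hcb, hbd, hb⟩ := Finset.mem_filter.1 hbT
  refine ⟨b, ⟨hcb, hbd⟩, ?_, hb⟩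
  by_contra! hlow
  have hne : (Finset.univ.filter (fun j => v j < b)).Nonempty := by
    by_contra hempty
    rw [Finset.not_nonempty_iff_eq_empty.1 hempty, Finset.sum_empty] at hlow
    norm_num at hlow
  obtain ⟨k, hk, hmax⟩ := Finset.exists_max_image _ v hne
  have hkb : v k < b := (Finset.mem_filter.1 hk).2
  have hbelow : ∀ j, v j < b → v j ≤ v k := fun j hj => hmax j (by simpa using hj)
  rcases lt_or_ge (v k) c with hkc | hkc
  · refine absurd (hlow.trans_le ?_) hc.not_gt
    refine Finset.sum_le_sum_of_subset_of_nonneg (fun j hj => ?_) fun j _ _ => hw.1 j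
    simp only [Finset.mem_filter, Finset.mem_univ, true_and] at hj ⊢
    exact (hbelow j hj).trans_lt hkc
  · have hsplit := Finset.sum_filter_add_sum_filter_not Finset.univ (fun j => v j < b) w
    have habove : Finset.univ.filter (fun j => ¬ v j < b) =
        Finset.univ.filter (fun j => v k < v j) := by
      ext j
      simp only [Finset.mem_filter, Finset.mem_univ, true_and]
      exact ⟨fun h => hkb.trans_le (not_lt.1 h), fun h h' => (hbelow j h').not_gt h⟩
    rw [habove, hw.2] at hsplit
    have hkT : v k ∈ T := Finset.mem_filter.2
      ⟨Finset.mem_insert_of_mem (Finset.mem_image_of_mem v (Finset.mem_univ k)),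
        hkc, hkb.le.trans hbd, by linarith⟩
    exact (hmin _ hkT).not_gt hkb

/-- Non-expansiveness of the environmental weighted median: every weighted median of
$Ax$ is within $‖x-y‖_∞$ of some weighted median of $Ay$. -/
theorem stmt13 {n l : ℕ}
    (A : Matrix (Fin l) (Fin n) ℝ) (hA : RowStochastic A)
    (m : Fin l → ℝ) (hm : IsWeightVec m) (x y : Fin n → ℝ) :
    ∀ a : ℝ, IsWMedian m (A.mulVec x) a →
      ∃ b : ℝ, IsWMedian m (A.mulVec y) b ∧ |a - b| ≤ ‖x - y‖ := by
  rintro a ⟨hlow, hhigh⟩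
  have hdist := fun i => abs_le.1 (hA.abs_mulVec_sub_le x y i)
  have hmono {p q : Fin l → Prop} [DecidablePred p] [DecidablePred q] (h : ∀ i, p i → q i) :
      ∑ i ∈ Finset.univ.filter p, m i ≤ ∑ i ∈ Finset.univ.filter q, m i :=
    Finset.sum_le_sum_of_subset_of_nonneg
      (Finset.monotone_filter_right _ fun i _ hi => h i hi) fun i _ _ => hm.1 i
  obtain ⟨b, ⟨hab, hba⟩, hb⟩ := hm.exists_isWMedian_mem_Icc (A.mulVec y)
    (c := a - ‖x - y‖) (d := a + ‖x - y‖) (by linarith [norm_nonneg (x - y)])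
    ((hmono fun i hi => by linarith [hdist i]).trans hlow)
    ((hmono fun i hi => by linarith [hdist i]).trans hhigh)
  exact ⟨b, hb, abs_le.2 ⟨by linarith, by linarith⟩⟩
end

section
/- Contraction estimate for the fully opinionated system: the map F satisfies ‖F(x) − F(y)‖_∞ ≤ (1−λ_min)·(1+γ_max)·‖x − y‖_∞ for all x, y ∈ ℝⁿ. In particular, if (1−λ_min)·γ_max < λ_min, then (1−λ_min)(1+γ_max) < 1 and F is a contraction on (ℝⁿ, ‖·‖_∞). -/
open Filter Topology

variable {n l : ℕ}

/-- Contraction estimate for the fully opinionated map $F$: it is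
$(1-λ_{\min})(1+γ_{\max})$-Lipschitz in the ℓ∞ norm, and under
$(1-λ_{\min})γ_{\max} < λ_{\min}$ this constant is $<1$, so $F$ is a contraction. -/
theorem stmt14 {n l : ℕ} [NeZero n]
    (lam γ : Fin n → ℝ) (u : Fin n → ℝ)
    (hlam : ∀ i, 0 < lam i ∧ lam i ≤ 1) (hγ : ∀ i, 0 ≤ γ i ∧ γ i ≤ 1)
    (W : Matrix (Fin n) (Fin n) ℝ) (M : Matrix (Fin n) (Fin l) ℝ)
    (A : Matrix (Fin l) (Fin n) ℝ)
    (hW : RowStochastic W) (hM : RowStochastic M) (hA : RowStochastic A)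
    (μ ν : Fin n → (Fin n → ℝ) → ℝ)
    (hμ : ∀ i x, IsWMedian (W i) x (μ i x))
    (hν : ∀ i x, IsWMedian (M i) (A.mulVec x) (ν i x))
    (hμne : ∀ i x y, |μ i x - μ i y| ≤ ‖x - y‖)
    (hνne : ∀ i x y, |ν i x - ν i y| ≤ ‖x - y‖)
    (F : (Fin n → ℝ) → (Fin n → ℝ))
    (hF : ∀ x i, F x i = lam i * u i + (1 - lam i) * ((1 - γ i) * μ i x + γ i * ν i x)) :
    (∀ x y : Fin n → ℝ,
      ‖F x - F y‖ ≤ (1 - lamMin lam) * (1 + gamMax γ) * ‖x - y‖) ∧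
    ((1 - lamMin lam) * gamMax γ < lamMin lam →
      (1 - lamMin lam) * (1 + gamMax γ) < 1 ∧
      ∃ K : NNReal, (K : ℝ) = (1 - lamMin lam) * (1 + gamMax γ) ∧ K < 1 ∧
        LipschitzWith K F) := by
  have hlb : ∀ i, lamMin lam ≤ lam i := fun i => ciInf_le (Set.finite_range lam).bddBelow i
  have hub : ∀ i, γ i ≤ gamMax γ := fun i => le_ciSup (Set.finite_range γ).bddAbove i
  have hl1 : 0 ≤ 1 - lamMin lam := sub_nonneg.2 ((hlb 0).trans (hlam 0).2)
  have hg0 : 0 ≤ gamMax γ := (hγ 0).1.trans (hub 0)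
  have hK : 0 ≤ (1 - lamMin lam) * (1 + gamMax γ) := by positivity
  have hmain : ∀ x y : Fin n → ℝ,
      ‖F x - F y‖ ≤ (1 - lamMin lam) * (1 + gamMax γ) * ‖x - y‖ := by
    intro x y
    refine (pi_norm_le_iff_of_nonneg (by positivity)).2 fun i => ?_
    have hli : 0 ≤ 1 - lam i := sub_nonneg.2 (hlam i).2
    have hγi : 0 ≤ 1 - γ i := sub_nonneg.2 (hγ i).2
    have hγ0 := (hγ i).1
    have hdiff : (F x - F y) i =
        (1 - lam i) * ((1 - γ i) * (μ i x - μ i y) + γ i * (ν i x - ν i y)) := by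
      rw [Pi.sub_apply, hF, hF]; ring
    rw [hdiff, Real.norm_eq_abs, abs_mul, abs_of_nonneg hli]
    calc (1 - lam i) * |(1 - γ i) * (μ i x - μ i y) + γ i * (ν i x - ν i y)|
        ≤ (1 - lam i) * ((1 - γ i) * ‖x - y‖ + γ i * ‖x - y‖) := by
          gcongr
          refine (abs_add_le _ _).trans ?_
          rw [abs_mul, abs_mul, abs_of_nonneg hγi, abs_of_nonneg hγ0]
          gcongr
          · exact hμne i x y
          · exact hνne i x y
      _ = (1 - lam i) * 1 * ‖x - y‖ := by ring
      _ ≤ (1 - lamMin lam) * (1 + gamMax γ) * ‖x - y‖ := by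
          gcongr
          · exact hlb i
          · linarith
  refine ⟨hmain, fun h => ?_⟩
  have hlt : (1 - lamMin lam) * (1 + gamMax γ) < 1 := by linarith
  refine ⟨hlt, ⟨_, hK⟩, rfl, hlt, LipschitzWith.of_dist_le_mul fun x y => ?_⟩
  rw [dist_eq_norm, dist_eq_norm]
  exact hmain x y
end
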